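/- Let L be a modular lattice of finite height. Then L forces solvable type if and only if the two-element lattice is not a homomorphic image of L, i.e., there is no surjective lattice homomorphism from L onto the two-element lattice {0,1}. -/

import Mathlib

/-- A commutator multiplication on a complete lattice `L`: a binary operation that is
commutative, below the meet, and distributes over arbitrary joins. -/
def IsCommutatorMult {L : Type*} [CompleteLattice L] (c : L → L → L) : Prop :=
  (∀ x y : L, c x y = c y x) ∧
  (∀ x y : L, c x y ≤ x ⊓ y) ∧
  (∀ (S : Set L) (y : L), c (sSup S) y = ⨆ x ∈ S, c x y)

/-- The residuation `(x : y)` associated with a commutator multiplication. -/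
def resid {L : Type*} [CompleteLattice L] (c : L → L → L) (x y : L) : L :=
  sSup {z : L | c z y ≤ x}

/-- `[α, β] ↗ [γ, δ]`, i.e. `δ = β ⊔ γ` and `α = β ⊓ γ`. -/
def TransUp {L : Type*} [Lattice L] (p q : L × L) : Prop :=
  q.2 = p.2 ⊔ q.1 ∧ p.1 = p.2 ⊓ q.1

/-- Projectivity of intervals: the equivalence relation generated by `↗`. -/
def ProjIntv {L : Type*} [Lattice L] : L × L → L × L → Prop :=
  Relation.EqvGen TransUp

/-- `η⁺ = ⋀ { β | η < β }`. -/
def mplus {L : Type*} [CompleteLattice L] (η : L) : L := sInf {β : L | η < β}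

/-- `ρ⁻ = ⋁ { α | α < ρ }`. -/
def jminus {L : Type*} [CompleteLattice L] (ρ : L) : L := sSup {α : L | α < ρ}

/-- `η` is meet irreducible if `η < η⁺`. -/
def MeetIrred {L : Type*} [CompleteLattice L] (η : L) : Prop := η < mplus η

/-- `ρ` is join irreducible if `ρ⁻ < ρ`. -/
def JoinIrred {L : Type*} [CompleteLattice L] (ρ : L) : Prop := jminus ρ < ρ

/-- `Γ(α,β) = ⋁ { η ∈ M(L) | [η,η⁺] ⟷ [α,β] }`. -/
def GammaEl {L : Type*} [CompleteLattice L] (α β : L) : L :=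
  sSup {η : L | MeetIrred η ∧ ProjIntv (η, mplus η) (α, β)}

/-- `Δ(α,β) = ⋁ { ρ ∈ J(L) | [ρ⁻,ρ] ⟷ [α,β] }`. -/
def DeltaEl {L : Type*} [CompleteLattice L] (α β : L) : L :=
  sSup {ρ : L | JoinIrred ρ ∧ ProjIntv (jminus ρ, ρ) (α, β)}

/-- A lonesome meet irreducible element. -/
def LonesomeMeet {L : Type*} [CompleteLattice L] (η : L) : Prop :=
  MeetIrred η ∧ ∀ φ : L, MeetIrred φ → ProjIntv (φ, mplus φ) (η, mplus η) → φ = η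

/-- A lonesome join irreducible element. -/
def LonesomeJoin {L : Type*} [CompleteLattice L] (ρ : L) : Prop :=
  JoinIrred ρ ∧ ∀ σ : L, JoinIrred σ → ProjIntv (jminus σ, σ) (jminus ρ, ρ) → σ = ρ

/-- The interval `[a,b]` projects into the interval `[c,d]`. -/
def ProjInto {L : Type*} [CompleteLattice L] (a b c d : L) : Prop :=
  ∃ a₁ b₁ : L, c ≤ a₁ ∧ a₁ ≤ b₁ ∧ b₁ ≤ d ∧ ProjIntv (a, b) (a₁, b₁)

/-- A complete congruence on a complete lattice. -/
def IsCompleteCongruence {L : Type*} [CompleteLattice L] (Θ : L → L → Prop) : Prop :=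
  Equivalence Θ ∧
  ∀ S : Set (L × L), (∀ p ∈ S, Θ p.1 p.2) →
    Θ (⨆ p ∈ S, p.1) (⨆ p ∈ S, p.2) ∧ Θ (⨅ p ∈ S, p.1) (⨅ p ∈ S, p.2)

/-- The largest commutator operation `⌊x,y⌋` on a complete lattice. -/
def lcomm {L : Type*} [CompleteLattice L] (x y : L) : L :=
  sSup {z : L | ∃ c : L → L → L, IsCommutatorMult c ∧ z = c x y}

/-- The derived series `γ₁ = 1, γ_{n+1} = [γ_n, γ_n]` (indexed from 0). -/
def derivedSeq {L : Type*} [CompleteLattice L] (c : L → L → L) : ℕ → L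
  | 0 => ⊤
  | n + 1 => c (derivedSeq c n) (derivedSeq c n)

/-- The lower central series `λ₁ = 1, λ_{n+1} = [1, λ_n]` (indexed from 0). -/
def lowerCentralSeq {L : Type*} [CompleteLattice L] (c : L → L → L) : ℕ → L
  | 0 => ⊤
  | n + 1 => c ⊤ (lowerCentralSeq c n)

/-- A commutator lattice is of solvable type if its derived series reaches `0`. -/
def SolvableType {L : Type*} [CompleteLattice L] (c : L → L → L) : Prop :=
  ∃ n, derivedSeq c n = ⊥

/-- A commutator lattice is of nilpotent type if its lower central series reaches `0`. -/
def NilpotentType {L : Type*} [CompleteLattice L] (c : L → L → L) : Prop :=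
  ∃ n, lowerCentralSeq c n = ⊥

/-- `L` forces abelian type if `⌊1,1⌋ = 0`. -/
def ForcesAbelianType (L : Type*) [CompleteLattice L] : Prop := lcomm (⊤ : L) ⊤ = ⊥

/-- `L` forces nilpotent type. -/
def ForcesNilpotentType (L : Type*) [CompleteLattice L] : Prop :=
  NilpotentType (lcomm : L → L → L)

/-- `L` forces solvable type. -/
def ForcesSolvableType (L : Type*) [CompleteLattice L] : Prop :=
  SolvableType (lcomm : L → L → L)

/-- `e` realizes `L` as a complete sublattice of `K`: `e` is injective and preserves
arbitrary nonempty joins and meets. -/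
def IsCompleteSublatticeEmb {L K : Type*} [CompleteLattice L] [CompleteLattice K]
    (e : L → K) : Prop :=
  Function.Injective e ∧
  (∀ S : Set L, S.Nonempty → e (sSup S) = sSup (e '' S)) ∧
  (∀ S : Set L, S.Nonempty → e (sInf S) = sInf (e '' S))

/-- A complete lattice homomorphism: preserves arbitrary joins and arbitrary meets. -/
def IsCompleteLatticeHom {L K : Type*} [CompleteLattice L] [CompleteLattice K]
    (h : L → K) : Prop :=
  (∀ S : Set L, h (sSup S) = sSup (h '' S)) ∧
  (∀ S : Set L, h (sInf S) = sInf (h '' S))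

/-- A lattice has finite height if there is a finite bound on the lengths of its chains. -/
def FiniteHeight (L : Type*) [Preorder L] : Prop :=
  ∃ n : ℕ, ∀ l : List L, l.Chain' (· < ·) → l.length ≤ n

/-- A lattice congruence: an equivalence relation compatible with `⊔` and `⊓`. -/
def IsLatticeCongruence {L : Type*} [Lattice L] (Θ : L → L → Prop) : Prop :=
  Equivalence Θ ∧
  ∀ a b x y : L, Θ a b → Θ x y → Θ (a ⊔ x) (b ⊔ y) ∧ Θ (a ⊓ x) (b ⊓ y)

/-- A lattice is simple if its only lattice congruences are equality and the all relation. -/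
def SimpleLattice (L : Type*) [Lattice L] : Prop :=
  ∀ Θ : L → L → Prop, IsLatticeCongruence Θ →
    (∀ a b : L, Θ a b ↔ a = b) ∨ (∀ a b : L, Θ a b)

theorem FiniteHeight.wellFoundedLT {L : Type*} [Preorder L] (hfin : FiniteHeight L) :
    WellFoundedLT L := by
  obtain ⟨n, hn⟩ := hfin
  refine ⟨RelEmbedding.wellFounded_iff_isEmpty.2 ⟨fun f => ?_⟩⟩
  have hanti : StrictAnti f := fun a b hab => f.map_rel_iff.2 hab
  have hchain := hn ((List.range (n + 1)).reverse.map f) <| by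
    refine List.Pairwise.isChain ?_
    rw [List.pairwise_map, List.pairwise_reverse]
    exact List.pairwise_lt_range.imp fun h => hanti h
  simp at hchain

theorem FiniteHeight.wellFoundedGT {L : Type*} [Preorder L] (hfin : FiniteHeight L) :
    WellFoundedGT L := by
  obtain ⟨n, hn⟩ := hfin
  refine ⟨RelEmbedding.wellFounded_iff_isEmpty.2 ⟨fun f => ?_⟩⟩
  have hmono : StrictMono f := fun a b hab => f.map_rel_iff.2 hab
  have hchain := hn ((List.range (n + 1)).map f) <| by
    refine List.Pairwise.isChain ?_
    rw [List.pairwise_map]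
    exact List.pairwise_lt_range.imp fun h => hmono h
  simp at hchain

namespace IsCommutatorMult

variable {L : Type*} [CompleteLattice L] {c : L → L → L}

theorem sup_left (hc : IsCommutatorMult c) (x y z : L) : c (x ⊔ y) z = c x z ⊔ c y z := by
  rw [← sSup_pair, hc.2.2, iSup_pair]

theorem sup_right (hc : IsCommutatorMult c) (x y z : L) : c z (x ⊔ y) = c z x ⊔ c z y := by
  rw [hc.1, hc.sup_left, hc.1 x, hc.1 y]

theorem mono_left (hc : IsCommutatorMult c) {x y : L} (hxy : x ≤ y) (z : L) :
    c x z ≤ c y z := by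
  rw [← sup_eq_right.2 hxy, hc.sup_left]
  exact le_sup_left

theorem le_left (hc : IsCommutatorMult c) (x y : L) : c x y ≤ x :=
  (hc.2.1 x y).trans inf_le_left

theorem le_right (hc : IsCommutatorMult c) (x y : L) : c x y ≤ y :=
  (hc.2.1 x y).trans inf_le_right

theorem le_lcomm (hc : IsCommutatorMult c) (x y : L) : c x y ≤ lcomm x y :=
  le_sSup ⟨c, hc, rfl⟩

theorem derivedSeq_antitone (hc : IsCommutatorMult c) : Antitone (derivedSeq c) :=
  antitone_nat_of_succ_le fun _ => hc.le_left _ _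

/-- If `α ⋖ β` is not centralized by `β`, then the centralizer of `[α, β]` is a prime ideal. -/
theorem not_inf_le_of_covBy (hc : IsCommutatorMult c) {α β x y : L} (hαβ : α ⋖ β)
    (hβ : ¬ c β β ≤ α) (hx : ¬ c x β ≤ α) (hy : ¬ c y β ≤ α) : ¬ c (x ⊓ y) β ≤ α := by
  have join : ∀ u, u ≤ β → ¬ u ≤ α → u ⊔ α = β := fun u hu hu' =>
    (hαβ.eq_or_eq le_sup_right (sup_le hu hαβ.le)).resolve_left
      fun h => hu' (h ▸ le_sup_left)
  have hw : ¬ c y (c x β) ≤ α := fun h => hy <| by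
    rw [← join _ (hc.le_right x β) hx, hc.sup_right]
    exact sup_le h (hc.le_right _ _)
  have hwβ : c y (c x β) ≤ β := (hc.le_right _ _).trans (hc.le_right _ _)
  have hwx : c y (c x β) ≤ x ⊓ y :=
    le_inf ((hc.le_right _ _).trans (hc.le_left _ _)) (hc.le_left _ _)
  intro h
  have hαc : c (c y (c x β) ⊔ α) β ≤ α := by
    rw [hc.sup_left]
    exact sup_le ((hc.mono_left hwx β).trans h) (hc.le_left _ _)
  rw [join _ hwβ hw] at hαc
  exact hβ hαc

end IsCommutatorMult

theorem isCommutatorMult_lcomm {L : Type*} [CompleteLattice L] :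
    IsCommutatorMult (lcomm : L → L → L) := by
  refine ⟨fun x y => ?_, fun x y => ?_, fun S y => le_antisymm ?_ ?_⟩
  · unfold lcomm
    congr 1
    ext z
    exact exists_congr fun c => and_congr_right fun hc => by rw [hc.1]
  · refine sSup_le ?_
    rintro _ ⟨c, hc, rfl⟩
    exact hc.2.1 x y
  · refine sSup_le ?_
    rintro _ ⟨c, hc, rfl⟩
    rw [hc.2.2]
    exact iSup₂_mono fun x _ => hc.le_lcomm x y
  · refine iSup₂_le fun x hx => sSup_le ?_
    rintro _ ⟨c, hc, rfl⟩
    exact (hc.mono_left (le_sSup hx) y).trans (hc.le_lcomm _ _)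

open Classical in
/-- A pair `(ρ, η)` splitting `L` into a principal filter and a principal ideal yields a
commutator multiplication with values `ρ` and `⊥`. -/
theorem isCommutatorMult_ite_of_splitting {L : Type*} [CompleteLattice L] {ρ η : L}
    (h : ∀ x, ρ ≤ x ↔ ¬ x ≤ η) :
    IsCommutatorMult fun x y : L => if ρ ≤ x ∧ ρ ≤ y then ρ else ⊥ := by
  refine ⟨fun x y => by simp only [and_comm], fun x y => ?_, fun S y => le_antisymm ?_ ?_⟩
  · dsimp only
    split_ifs with hxy
    · exact le_inf hxy.1 hxy.2
    · exact bot_le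
  · dsimp only
    split_ifs with hxy
    · obtain ⟨hS, hy⟩ := hxy
      rw [h, sSup_le_iff] at hS
      push Not at hS
      obtain ⟨x, hxS, hx⟩ := hS
      exact le_iSup₂_of_le x hxS (by rw [if_pos ⟨(h x).2 hx, hy⟩])
    · exact bot_le
  · refine iSup₂_le fun x hx => ?_
    dsimp only
    split_ifs with h₁ h₂ h₂
    · exact le_rfl
    · exact absurd ⟨h₁.1.trans (le_sSup hx), h₁.2⟩ h₂
    · exact bot_le
    · exact bot_le

/-- a modular lattice of finite height forces solvable type iff the
two-element lattice (modelled by `Prop`) is not a homomorphic image of it. -/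
theorem statement18 {L : Type*} [CompleteLattice L] [IsModularLattice L]
    (hfin : FiniteHeight L) :
    ForcesSolvableType L ↔
      ¬ ∃ h : L → Prop,
        (∀ a b : L, h (a ⊔ b) = (h a ∨ h b)) ∧
        (∀ a b : L, h (a ⊓ b) = (h a ∧ h b)) ∧
        Function.Surjective h := by
  have hlt := hfin.wellFoundedLT
  have hgt := hfin.wellFoundedGT
  have hl := isCommutatorMult_lcomm (L := L)
  constructor
  · rintro ⟨n, hn⟩ ⟨h, hsup, hinf, hsurj⟩
    have hmono : ∀ {a b}, a ≤ b → h a → h b := fun {a b} hab ha => by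
      rw [← sup_eq_right.2 hab, hsup]
      exact Or.inl ha
    obtain ⟨a, ha⟩ := hsurj True
    obtain ⟨b, hb⟩ := hsurj False
    obtain ⟨ρ, hρ, hρmin⟩ := hlt.wf.has_min {x | h x} ⟨a, of_eq_true ha⟩
    obtain ⟨η, hη, hηmax⟩ := hgt.wf.has_min {x | ¬ h x} ⟨b, of_eq_false hb⟩
    have hρ_iff : ∀ x, ρ ≤ x ↔ h x := fun x => by
      refine ⟨fun hx => hmono hx hρ, fun hx => ?_⟩
      by_contra hle
      refine hρmin (ρ ⊓ x) ?_ (inf_lt_left.2 hle)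
      change h (ρ ⊓ x)
      rw [hinf]
      exact ⟨hρ, hx⟩
    have hη_iff : ∀ x, x ≤ η ↔ ¬ h x := fun x => by
      refine ⟨fun hx hx' => hη (hmono hx hx'), fun hx => ?_⟩
      by_contra hle
      refine hηmax (η ⊔ x) ?_ (left_lt_sup.2 hle)
      change ¬ h (η ⊔ x)
      rw [hsup]
      exact not_or.2 ⟨hη, hx⟩
    have hc := isCommutatorMult_ite_of_splitting (ρ := ρ) (η := η)
      fun x => by rw [hρ_iff, hη_iff, not_not]
    have hle : ∀ k, ρ ≤ derivedSeq (lcomm : L → L → L) k := by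
      intro k
      induction k with
      | zero => exact le_top
      | succ k ih =>
        refine le_trans ?_ (hc.le_lcomm _ _)
        rw [if_pos ⟨ih, ih⟩]
    have hbot := hle n
    rw [hn, hρ_iff] at hbot
    exact (hη_iff ⊥).1 bot_le hbot
  · intro hno
    by_contra hsol
    obtain ⟨n, hn⟩ := WellFoundedLT.antitone_chain_condition hl.derivedSeq_antitone
    set β := derivedSeq (lcomm : L → L → L) n
    have hββ : lcomm β β = β := (hn (n + 1) n.le_succ).symm
    have hβ : ⊥ < β := bot_lt_iff_ne_bot.2 fun h => hsol ⟨n, h⟩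
    obtain ⟨α, hαβ⟩ : ∃ α, α ⋖ β := by
      obtain ⟨α, hα, hmax⟩ := hgt.wf.has_min {x | x < β} ⟨⊥, hβ⟩
      exact ⟨α, hα, fun z hz hz' => hmax z hz' hz⟩
    have hnot : ¬ lcomm β β ≤ α := by
      rw [hββ]
      exact hαβ.lt.not_ge
    refine hno ⟨fun x => ¬ lcomm x β ≤ α, fun x y => ?_, fun x y => ?_, fun p => ?_⟩
    · dsimp only
      rw [hl.sup_left, sup_le_iff, not_and_or]
    · refine propext ⟨fun h => ⟨fun hx => h ?_, fun hy => h ?_⟩,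
        fun h => hl.not_inf_le_of_covBy hαβ hnot h.1 h.2⟩
      · exact (hl.mono_left inf_le_left β).trans hx
      · exact (hl.mono_left inf_le_right β).trans hy
    · by_cases hp : p
      · exact ⟨β, propext (iff_of_true hnot hp)⟩
      · exact ⟨⊥, propext (iff_of_false (not_not.2 ((hl.le_left _ _).trans bot_le)) hp)⟩
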